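/- Let φ : H → GL(m,ℤ) be an integral representation of a finite group H. Then RF_{ℤ^m, Inv(φ), B_{ℤ^m}} ≈ RF_{ℤ^m, Com(φ), B_{ℤ^m}}. -/

import Mathlib

/-- The word ball of radius `r` in an additive group with respect to a finite
(generating) set `S`: sums of at most `r` elements of `S ∪ (-S)`. -/
def addWordBall {A : Type*} [AddGroup A] (S : Finset A) (r : ℝ) : Set A :=
  {a | ∃ l : List A, (∀ x ∈ l, x ∈ S ∨ -x ∈ S) ∧ (l.length : ℝ) ≤ r ∧ l.sum = a}

/-- The divisibility function `D_{A,P}(a) = min {[A:N] : N ∈ P, a ∉ N}`, with value `∞`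
when no such `N` exists (in particular at `a = 0`). -/
noncomputable def addDivFn {A : Type*} [AddGroup A] (P : Set (AddSubgroup A)) (a : A) : ℕ∞ :=
  sInf {n : ℕ∞ | ∃ N ∈ P, a ∉ N ∧ n = (N.index : ℕ∞)}

/-- The residual finiteness growth function
`RF_{A,P,B_A}(r) = max {D_{A,P}(a) : 0 ≠ a ∈ B_A(r)}` (as a real-valued function,
taking the value `1` on an empty set of elements). -/
noncomputable def addRF {A : Type*} [AddGroup A] (P : Set (AddSubgroup A)) (S : Finset A)
    (r : ℝ) : ℝ :=
  sSup (insert 1 ((fun a => ((addDivFn P a).toNat : ℝ)) '' (addWordBall S r \ {0})))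

/-- `f ⪯ g`: there is `C > 0` with `f(r) ≤ C·g(C·r)` for all `r ≥ max {1, 1/C}`. -/
def GrowthLE (f g : ℝ → ℝ) : Prop :=
  ∃ C : ℝ, 0 < C ∧ ∀ r : ℝ, max 1 (1 / C) ≤ r → f r ≤ C * g (C * r)

/-- `f ≈ g`: `f ⪯ g` and `g ⪯ f`. -/
def GrowthEquiv (f g : ℝ → ℝ) : Prop :=
  GrowthLE f g ∧ GrowthLE g f

/-- The endomorphism of `ℤ^m` given by an integer matrix. -/
def intAct {m : ℕ} (M : Matrix (Fin m) (Fin m) ℤ) : (Fin m → ℤ) →+ (Fin m → ℤ) :=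
  M.mulVecLin.toAddMonoidHom

/-- `Inv(φ)`: the finite-index subgroups of `ℤ^m` invariant under the integral
representation `φ : H → GL(m,ℤ)`. -/
def InvSet {H : Type*} [Group H] {m : ℕ}
    (φ : H →* Matrix.GeneralLinearGroup (Fin m) ℤ) : Set (AddSubgroup (Fin m → ℤ)) :=
  {N | N.FiniteIndex ∧
    ∀ h : H, N.map (intAct ((φ h : Matrix (Fin m) (Fin m) ℤ))) = N}

/-- A `ℂ`-subspace `W ⊆ ℂ^m` is invariant under the (complexified) family of integer
matrices `ρ`. -/
def InvariantC {H : Type*} {m : ℕ} (ρ : H → Matrix (Fin m) (Fin m) ℤ)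
    (W : Submodule ℂ (Fin m → ℂ)) : Prop :=
  ∀ h : H, ∀ v ∈ W, ((ρ h).map (Int.cast : ℤ → ℂ)).mulVec v ∈ W

/-- `W` is an irreducible `ℂ`-subrepresentation: nonzero, invariant, and containing
no proper nonzero invariant subspace. -/
def IsIrredC {H : Type*} {m : ℕ} (ρ : H → Matrix (Fin m) (Fin m) ℤ)
    (W : Submodule ℂ (Fin m → ℂ)) : Prop :=
  W ≠ ⊥ ∧ InvariantC ρ W ∧
    ∀ W' : Submodule ℂ (Fin m → ℂ), W' ≤ W → W' ≠ ⊥ → InvariantC ρ W' → W' = W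

/-- The image subgroup `B(ℤ^m) ⊆ ℤ^m` of an integer matrix `B`. -/
def matRange {m : ℕ} (B : Matrix (Fin m) (Fin m) ℤ) : AddSubgroup (Fin m → ℤ) :=
  (intAct B).range

/-- `Com(φ)`: the subgroups in `Inv(φ)` of the form `B(ℤ^m)` for an integer matrix
`B` with `det B ≠ 0` commuting with every `φ(h)`. -/
def ComSet {H : Type*} [Group H] {m : ℕ}
    (φ : H →* Matrix.GeneralLinearGroup (Fin m) ℤ) : Set (AddSubgroup (Fin m → ℤ)) :=
  {N | N ∈ InvSet φ ∧ ∃ B : Matrix (Fin m) (Fin m) ℤ, B.det ≠ 0 ∧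
    (∀ h : H, B * ((φ h : Matrix (Fin m) (Fin m) ℤ)) =
      ((φ h : Matrix (Fin m) (Fin m) ℤ)) * B) ∧
    N = matRange B}

/-- A `ℚ`-subspace `W ⊆ ℚ^m` is invariant under the family of integer matrices `ρ`. -/
def InvariantQ {H : Type*} {m : ℕ} (ρ : H → Matrix (Fin m) (Fin m) ℤ)
    (W : Submodule ℚ (Fin m → ℚ)) : Prop :=
  ∀ h : H, ∀ v ∈ W, ((ρ h).map (Int.cast : ℤ → ℚ)).mulVec v ∈ W


theorem finite_addWordBall {A : Type*} [AddGroup A] (S : Finset A) (r : ℝ) :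
    (addWordBall S r).Finite := by
  have hT : {x : A | x ∈ S ∨ -x ∈ S}.Finite :=
    S.finite_toSet.union (S.finite_toSet.preimage neg_injective.injOn)
  have := hT.to_subtype
  refine ((List.finite_length_le {x : A | x ∈ S ∨ -x ∈ S} ⌊r⌋₊).image
    fun l => (l.map Subtype.val).sum).subset ?_
  rintro a ⟨l, hl, hlr, rfl⟩
  refine ⟨l.pmap Subtype.mk hl, ?_, ?_⟩
  · simpa using Nat.le_floor hlr
  · simp [List.map_pmap]

theorem addWordBall_mono {A : Type*} [AddGroup A] (S : Finset A) {r s : ℝ} (h : r ≤ s) :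
    addWordBall S r ⊆ addWordBall S s :=
  fun _ ⟨l, hl, hlr, hs⟩ => ⟨l, hl, hlr.trans h, hs⟩

theorem growthLE_addRF_of_addDivFn_le {A : Type*} [AddGroup A] {P Q : Set (AddSubgroup A)}
    (S : Finset A) (C : ℕ) (hC : 1 ≤ C)
    (h : ∀ a : A, a ≠ 0 → (addDivFn P a).toNat ≤ C * (addDivFn Q a).toNat) :
    GrowthLE (addRF P S) (addRF Q S) := by
  have hC' : (1 : ℝ) ≤ C := by exact_mod_cast hC
  refine ⟨C, by positivity, fun r hr => ?_⟩
  have hr1 : 1 ≤ r := (le_max_left _ _).trans hr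
  have hbdd : BddAbove (insert 1 ((fun a => ((addDivFn Q a).toNat : ℝ)) ''
      (addWordBall S (C * r) \ {0}))) :=
    ((((finite_addWordBall S _).subset Set.sdiff_subset).image _).insert 1).bddAbove
  have hone : 1 ≤ addRF Q S (C * r) := le_csSup hbdd (Set.mem_insert _ _)
  refine csSup_le (Set.insert_nonempty _ _) ?_
  rintro _ (rfl | ⟨a, ⟨ha, ha0⟩, rfl⟩)
  · nlinarith
  · have hle : ((addDivFn Q a).toNat : ℝ) ≤ addRF Q S (C * r) :=
      le_csSup hbdd (Set.mem_insert_of_mem _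
        ⟨a, ⟨addWordBall_mono S (by nlinarith) ha, ha0⟩, rfl⟩)
    calc ((addDivFn P a).toNat : ℝ) ≤ C * (addDivFn Q a).toNat := by
          exact_mod_cast h a ha0
      _ ≤ C * addRF Q S (C * r) := by gcongr

theorem index_matRange {m : ℕ} (B : Matrix (Fin m) (Fin m) ℤ) (hB : B.det ≠ 0) :
    (matRange B).index = B.det.natAbs := by
  have hinj : Function.Injective B.mulVecLin := by
    rw [← LinearMap.ker_eq_bot, ← Matrix.toLin'_apply']
    exact (Matrix.ker_toLin'_eq_bot_iff).2 fun v hv =>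
      by_contra fun h => hB (Matrix.exists_mulVec_eq_zero_iff.1 ⟨v, h, hv⟩)
  have key := Submodule.natAbs_det_equiv B.mulVecLin.range
    (LinearEquiv.ofInjective B.mulVecLin hinj)
  have hdet : LinearMap.det B.mulVecLin = B.det := by
    rw [← Matrix.toLin'_apply', LinearMap.det_toLin']
  rw [← hdet]
  exact key.symm

theorem intAct_apply {m : ℕ} (M : Matrix (Fin m) (Fin m) ℤ) (v : Fin m → ℤ) :
    intAct M v = M.mulVec v := rfl

theorem mem_matRange {m : ℕ} {B : Matrix (Fin m) (Fin m) ℤ} {v : Fin m → ℤ} :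
    v ∈ matRange B ↔ ∃ u, B.mulVec u = v := Iff.rfl

theorem matRange_mem_comSet {H : Type*} [Group H] {m : ℕ}
    (φ : H →* Matrix.GeneralLinearGroup (Fin m) ℤ) (B : Matrix (Fin m) (Fin m) ℤ)
    (hB : B.det ≠ 0)
    (hcomm : ∀ h : H, B * (φ h : Matrix (Fin m) (Fin m) ℤ) =
      (φ h : Matrix (Fin m) (Fin m) ℤ) * B) :
    matRange B ∈ ComSet φ := by
  refine ⟨⟨⟨?_⟩, fun h => ?_⟩, B, hB, hcomm, rfl⟩
  · rw [index_matRange B hB]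
    simpa using hB
  · ext v
    simp only [AddSubgroup.mem_map, mem_matRange, intAct_apply]
    constructor
    · rintro ⟨_, ⟨u, rfl⟩, rfl⟩
      exact ⟨(φ h : Matrix (Fin m) (Fin m) ℤ).mulVec u, by simp [hcomm]⟩
    · rintro ⟨u, rfl⟩
      refine ⟨_, ⟨((φ h)⁻¹ : Matrix.GeneralLinearGroup (Fin m) ℤ).1.mulVec u, rfl⟩, ?_⟩
      rw [Matrix.mulVec_mulVec, ← hcomm, ← Matrix.mulVec_mulVec, Matrix.mulVec_mulVec _ (φ h).1,
        ← Units.val_mul, mul_inv_cancel, Units.val_one, Matrix.one_mulVec]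

/-- Pigeonhole principle: a finite-index subgroup of `ℤ^w` contains a nonzero vector whose entries
are bounded by the `w`-th root of the index. -/
theorem exists_short_mem {w : ℕ} (hw : w ≠ 0) (M : AddSubgroup (Fin w → ℤ))
    (hM : M.index ≠ 0) :
    ∃ R : ℕ, R ^ w ≤ M.index ∧ ∃ x ∈ M, x ≠ 0 ∧ ∀ s, |x s| ≤ R := by
  obtain ⟨R, hR, hR'⟩ : ∃ R : ℕ, R ^ w ≤ M.index ∧ M.index < (R + 1) ^ w :=
    ⟨Nat.nthRoot w M.index, by simp [hw], Nat.lt_pow_nthRoot_add_one hw _⟩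
  refine ⟨R, hR, ?_⟩
  have : M.FiniteIndex := ⟨hM⟩
  have := Fintype.ofFinite ((Fin w → ℤ) ⧸ M)
  let g : (Fin w → Fin (R + 1)) → (Fin w → ℤ) := fun c s => ((c s : ℕ) : ℤ)
  obtain ⟨c, d, hcd, he⟩ := Fintype.exists_ne_map_eq_of_card_lt
    (fun c => (QuotientAddGroup.mk (g c) : (Fin w → ℤ) ⧸ M)) (by
      rw [← Nat.card_eq_fintype_card]
      simpa [AddSubgroup.index] using hR')
  refine ⟨-g c + g d, QuotientAddGroup.eq.1 he, fun h0 => hcd ?_, fun s => ?_⟩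
  · funext s
    have := congrFun h0 s
    simp only [Pi.add_apply, Pi.neg_apply, Pi.zero_apply, g] at this
    ext
    omega
  · have h1 := (c s).2
    have h2 := (d s).2
    simp only [Pi.add_apply, Pi.neg_apply, g, abs_le]
    omega

/-- The average over `H` of the rank one matrix `x ⊗ e_j` under conjugation by a (rescaled)
integral representation `r`. -/
def conjSum {H : Type*} [Group H] [Fintype H] {w : ℕ} (r : H → Matrix (Fin w) (Fin w) ℤ)
    (x : Fin w → ℤ) (j : Fin w) : Matrix (Fin w) (Fin w) ℤ :=
  ∑ h : H, r h * Matrix.vecMulVec x (Pi.single j 1) * r h⁻¹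

theorem conjSum_comm {H : Type*} [Group H] [Fintype H] {w : ℕ}
    {r : H → Matrix (Fin w) (Fin w) ℤ} {c : ℤ} (hr : ∀ g h, r g * r h = c • r (g * h))
    (x : Fin w → ℤ) (j : Fin w) (g : H) : conjSum r x j * r g = r g * conjSum r x j := by
  rw [conjSum, Finset.sum_mul, Finset.mul_sum, ← Equiv.sum_comp (Equiv.mulLeft g)]
  refine Finset.sum_congr rfl fun h _ => ?_
  rw [Equiv.coe_mulLeft, mul_assoc, hr, ← mul_assoc, ← mul_assoc, hr]
  simp [-zsmul_eq_mul, -zsmul_one]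

theorem trace_conjSum {H : Type*} [Group H] [Fintype H] {w : ℕ}
    {r : H → Matrix (Fin w) (Fin w) ℤ} {c : ℤ} (hr : ∀ g h, r g * r h = c • r (g * h))
    (hr1 : r 1 = c • 1) (x : Fin w → ℤ) (j : Fin w) :
    (conjSum r x j).trace = Fintype.card H * (c * c * x j) := by
  rw [conjSum, Matrix.trace_sum, Finset.sum_congr rfl fun h _ => ?_, Finset.sum_const,
    Finset.card_univ, nsmul_eq_mul]
  rw [Matrix.trace_mul_comm, ← mul_assoc, hr, inv_mul_cancel, hr1]
  simp [-zsmul_eq_mul, -zsmul_one, mul_assoc]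

theorem abs_conjSum_apply_le {H : Type*} [Group H] [Fintype H] {w : ℕ}
    {r : H → Matrix (Fin w) (Fin w) ℤ} {b R : ℤ} (hb : ∀ h p q, |r h p q| ≤ b) {x : Fin w → ℤ}
    (hx : ∀ s, |x s| ≤ R) (j p q : Fin w) :
    |conjSum r x j p q| ≤ Fintype.card H * (w * (b * R) * b) := by
  have hb0 : 0 ≤ b := (abs_nonneg _).trans (hb 1 p q)
  have hR0 : 0 ≤ R := (abs_nonneg _).trans (hx j)
  have h1 : ∀ h, (r h * Matrix.vecMulVec x (Pi.single j 1) * r h⁻¹) p q =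
      (∑ s, r h p s * x s) * r h⁻¹ j q := fun h => by
    rw [Matrix.mul_vecMulVec, Matrix.vecMulVec_mul]
    simp [Matrix.vecMulVec_apply, Matrix.mulVec, dotProduct]
  rw [conjSum, Matrix.sum_apply]
  refine (Finset.abs_sum_le_sum_abs _ _).trans ?_
  rw [← Finset.card_univ, ← nsmul_eq_mul]
  refine Finset.sum_le_card_nsmul _ _ _ fun h _ => ?_
  rw [h1, abs_mul]
  refine mul_le_mul ?_ (hb _ _ _) (abs_nonneg _) (by positivity)
  refine (Finset.abs_sum_le_sum_abs _ _).trans ?_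
  refine (Finset.sum_le_card_nsmul _ _ (b * R) fun s _ => ?_).trans (by simp)
  rw [abs_mul]
  exact mul_le_mul (hb _ _ _) (hx _) (abs_nonneg _) hb0

theorem conjSum_mulVec {H : Type*} [Group H] [Fintype H] {w : ℕ}
    (r : H → Matrix (Fin w) (Fin w) ℤ) (x : Fin w → ℤ) (j : Fin w) (l : Fin w → ℤ) :
    (conjSum r x j).mulVec l = ∑ h : H, (r h⁻¹).mulVec l j • (r h).mulVec x := by
  rw [conjSum, Matrix.sum_mulVec]
  refine Finset.sum_congr rfl fun h _ => ?_
  rw [← Matrix.mulVec_mulVec, ← Matrix.mulVec_mulVec, Matrix.vecMulVec_mulVec, Matrix.mulVec_smul]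
  simp

theorem det_smul_one_add_mul {m w : ℕ} (I : Matrix (Fin m) (Fin w) ℤ)
    (P : Matrix (Fin w) (Fin m) ℤ) (c : ℤ) (hc : c ≠ 0) (hPI : P * I = c • 1)
    (y : Matrix (Fin w) (Fin w) ℤ) :
    (c • 1 - I * P + I * y * P : Matrix (Fin m) (Fin m) ℤ).det = c ^ m * y.det := by
  have hcQ : (c : ℚ) ≠ 0 := by exact_mod_cast hc
  set IQ : Matrix (Fin m) (Fin w) ℚ := I.map (Int.castRingHom ℚ) with hIQ
  set PQ : Matrix (Fin w) (Fin m) ℚ := P.map (Int.castRingHom ℚ) with hPQ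
  set yQ : Matrix (Fin w) (Fin w) ℚ := y.map (Int.castRingHom ℚ) with hyQ
  have hPIQ : PQ * IQ = (c : ℚ) • 1 := by
    rw [hPQ, hIQ, ← Matrix.map_mul, hPI]
    ext i j
    by_cases hij : i = j <;> simp [-zsmul_eq_mul, -zsmul_one, hij]
  have hmap : (c • 1 - I * P + I * y * P : Matrix (Fin m) (Fin m) ℤ).map (Int.castRingHom ℚ) =
      (c : ℚ) • (1 + ((c : ℚ)⁻¹ • IQ * (yQ - 1)) * PQ) := by
    have h1 : (c • 1 - I * P + I * y * P : Matrix (Fin m) (Fin m) ℤ).map (Int.castRingHom ℚ) =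
        (c : ℚ) • 1 - IQ * PQ + IQ * yQ * PQ := by
      rw [hIQ, hPQ, hyQ, ← Matrix.map_mul, ← Matrix.map_mul, ← Matrix.map_mul]
      ext i j
      simp [-zsmul_eq_mul, -zsmul_one, Matrix.one_apply, apply_ite]
    rw [h1, smul_add, Matrix.smul_mul, Matrix.smul_mul, smul_smul, mul_inv_cancel₀ hcQ, one_smul,
      Matrix.mul_sub, Matrix.sub_mul, Matrix.mul_one]
    abel
  have hdet : (((c • 1 - I * P + I * y * P : Matrix (Fin m) (Fin m) ℤ).det : ℤ) : ℚ) =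
      c ^ m * (y.det : ℤ) := by
    have e1 := (Int.castRingHom ℚ).map_det (c • 1 - I * P + I * y * P : Matrix (Fin m) (Fin m) ℤ)
    have e2 := (Int.castRingHom ℚ).map_det y
    rw [RingHom.mapMatrix_apply] at e1 e2
    rw [eq_intCast] at e1 e2
    rw [e1, e2, hmap, Matrix.det_smul, Matrix.det_one_add_mul_comm, Matrix.smul_mul,
      Matrix.mul_smul, ← Matrix.mul_assoc, hPIQ, Matrix.smul_mul, smul_smul,
      inv_mul_cancel₀ hcQ, one_smul, one_mul, add_sub_cancel, Fintype.card_fin]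
  exact_mod_cast hdet

theorem exists_comm_of_component {H : Type*} [Group H] [Fintype H] {m w : ℕ}
    (φ : H →* Matrix.GeneralLinearGroup (Fin m) ℤ) (I : Matrix (Fin m) (Fin w) ℤ)
    (P : Matrix (Fin w) (Fin m) ℤ) (c : ℤ) (hc : c ≠ 0) (hPI : P * I = c • 1)
    (hcomm : ∀ h, I * P * (φ h).1 = (φ h).1 * (I * P))
    (schur : ∀ y : Matrix (Fin w) (Fin w) ℤ,
      (∀ h, y * (P * (φ h).1 * I) = P * (φ h).1 * I * y) → y ≠ 0 → y.det ≠ 0) :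
    ∃ C : ℕ, ∀ N ∈ InvSet φ, ∀ a, (∀ n ∈ N, (I * P).mulVec a ≠ c • n) →
      ∃ N' ∈ ComSet φ, a ∉ N' ∧ N'.index ≤ C * N.index := by
  set r : H → Matrix (Fin w) (Fin w) ℤ := fun h => P * (φ h).1 * I with hrdef
  have hIr : ∀ h, I * r h = c • ((φ h).1 * I) := fun h => by
    calc I * r h = (I * P * (φ h).1) * I := by simp only [hrdef, Matrix.mul_assoc]
      _ = (φ h).1 * I * (P * I) := by rw [hcomm]; simp only [Matrix.mul_assoc]
      _ = _ := by rw [hPI]; simp [-zsmul_eq_mul, -zsmul_one]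
  have hrP : ∀ h, r h * P = c • (P * (φ h).1) := fun h => by
    calc r h * P = P * ((φ h).1 * (I * P)) := by simp only [hrdef, Matrix.mul_assoc]
      _ = (P * I) * (P * (φ h).1) := by rw [← hcomm]; simp only [Matrix.mul_assoc]
      _ = _ := by rw [hPI]; simp [-zsmul_eq_mul, -zsmul_one]
  have hr : ∀ g h, r g * r h = c • r (g * h) := fun g h => by
    calc r g * r h = P * (φ g).1 * (I * r h) := by
          simp only [hrdef, Matrix.mul_assoc]
      _ = _ := by rw [hIr]; simp only [hrdef, map_mul, Units.val_mul, Matrix.mul_smul,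
                    Matrix.mul_assoc]
  have hr1 : r 1 = c • 1 := by simp [hrdef, hPI]
  obtain ⟨b, hb⟩ : ∃ b : ℕ, ∀ h p q, |r h p q| ≤ b := by
    obtain ⟨b, hb⟩ := (Set.finite_range
      fun t : H × Fin w × Fin w => (r t.1 t.2.1 t.2.2).natAbs).bddAbove
    refine ⟨b, fun h p q => ?_⟩
    have := hb ⟨(h, p, q), rfl⟩
    rw [Int.abs_eq_natAbs]
    exact_mod_cast this
  let K : ℕ := Fintype.card H * (w * b * b)
  refine ⟨c.natAbs ^ m * (w.factorial * K ^ w * c.natAbs ^ m), fun N hN a ha => ?_⟩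
  obtain ⟨⟨hNfin⟩, hNinv⟩ := hN
  set cN : AddSubgroup (Fin m → ℤ) := N.map (intAct (c • 1)) with hcN
  have hmem : ∀ v, v ∈ cN ↔ ∃ n ∈ N, c • n = v := fun v => by
    simp [hcN, intAct_apply, Matrix.smul_mulVec, -zsmul_eq_mul, -zsmul_one]
  have hcNindex : cN.index = N.index * c.natAbs ^ m := by
    have hker : (intAct (c • 1 : Matrix (Fin m) (Fin m) ℤ)).ker = ⊥ := by
      rw [AddMonoidHom.ker_eq_bot_iff]
      intro u v huv
      simp only [intAct_apply, Matrix.smul_mulVec, Matrix.one_mulVec] at huv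
      exact smul_right_injective _ hc huv
    have hdet : (c • 1 : Matrix (Fin m) (Fin m) ℤ).det = c ^ m := by
      simp [-zsmul_eq_mul, -zsmul_one]
    have hidx := index_matRange (c • 1 : Matrix (Fin m) (Fin m) ℤ)
      (by rw [hdet]; exact pow_ne_zero _ hc)
    rw [hcN, AddSubgroup.index_map, hker, sup_bot_eq]
    rw [matRange] at hidx
    rw [hidx, hdet, Int.natAbs_pow]
  have hcNinv : ∀ h v, v ∈ cN → (φ h).1.mulVec v ∈ cN := fun h v hv => by
    obtain ⟨n, hn, rfl⟩ := (hmem v).1 hv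
    refine (hmem _).2 ⟨(φ h).1.mulVec n, ?_, by rw [Matrix.mulVec_smul]⟩
    have : (φ h).1.mulVec n ∈ N.map (intAct (φ h).1) := ⟨n, hn, rfl⟩
    rwa [hNinv] at this
  have hcN0 : cN.index ≠ 0 := by
    rw [hcNindex]
    exact mul_ne_zero hNfin (pow_ne_zero _ (by simpa using hc))
  set M : AddSubgroup (Fin w → ℤ) := cN.comap I.mulVecLin.toAddMonoidHom with hM
  have hMmem : ∀ z, z ∈ M ↔ I.mulVec z ∈ cN := fun z => Iff.rfl
  have hMdvd : M.index ∣ cN.index := by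
    rw [hM, AddSubgroup.index_comap]
    exact AddSubgroup.relIndex_dvd_index_of_normal _ _
  have hM0 : M.index ≠ 0 := fun h0 => hcN0 (by rwa [h0, zero_dvd_iff] at hMdvd)
  have haM : P.mulVec a ∉ M := fun h => by
    obtain ⟨n, hn, he⟩ := (hmem _).1 ((hMmem _).1 h)
    exact ha n hn (by rw [he, Matrix.mulVec_mulVec])
  have hw : w ≠ 0 := by
    rintro rfl
    exact haM (by rw [Subsingleton.elim (P.mulVec a) 0]; exact M.zero_mem)
  obtain ⟨R, hR, x, hxM, hx0, hxR⟩ := exists_short_mem hw M hM0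
  obtain ⟨j, hj⟩ := Function.ne_iff.1 hx0
  set y := conjSum r x j with hy
  have hyne : y ≠ 0 := fun h0 => by
    have := trace_conjSum hr hr1 x j
    rw [← hy, h0, Matrix.trace_zero] at this
    have h4 : (Fintype.card H : ℤ) ≠ 0 := by exact_mod_cast Fintype.card_ne_zero
    exact mul_ne_zero h4 (mul_ne_zero (mul_ne_zero hc hc) hj) this.symm
  have hycomm : ∀ h, y * r h = r h * y := conjSum_comm hr x j
  have hydet : y.det ≠ 0 := schur y hycomm hyne
  have hyN : ∀ l, I.mulVec (y.mulVec l) ∈ cN := fun l => by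
    rw [hy, conjSum_mulVec, Matrix.mulVec_sum]
    refine cN.sum_mem fun h _ => ?_
    rw [Matrix.mulVec_smul, Matrix.mulVec_mulVec, hIr, Matrix.smul_mulVec,
      ← Matrix.mulVec_mulVec x]
    exact cN.zsmul_mem (cN.zsmul_mem (hcNinv _ _ hxM) _) _
  have hBdet := det_smul_one_add_mul I P c hc hPI y
  have hB0 : (c • 1 - I * P + I * y * P : Matrix (Fin m) (Fin m) ℤ).det ≠ 0 := by
    rw [hBdet]; exact mul_ne_zero (pow_ne_zero _ hc) hydet
  refine ⟨_, matRange_mem_comSet φ (c • 1 - I * P + I * y * P) hB0 fun h => ?_, ?_, ?_⟩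
  · have h1 : I * y * P * (φ h).1 = (φ h).1 * (I * y * P) := by
      refine smul_right_injective _ hc ?_
      calc c • (I * y * P * (φ h).1) = I * y * (c • (P * (φ h).1)) := by
            simp only [Matrix.mul_smul, Matrix.mul_assoc]
        _ = I * (y * r h) * P := by rw [← hrP]; simp only [Matrix.mul_assoc]
        _ = (I * r h) * (y * P) := by rw [hycomm]; simp only [Matrix.mul_assoc]
        _ = c • ((φ h).1 * (I * y * P)) := by
            rw [hIr]; simp only [Matrix.smul_mul, Matrix.mul_assoc]
    rw [Matrix.add_mul, Matrix.sub_mul, Matrix.mul_add, Matrix.mul_sub, h1, hcomm]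
    simp [-zsmul_eq_mul, -zsmul_one]
  · rintro ⟨v, hv⟩
    refine haM ((hMmem _).2 ?_)
    have hPB : P * (c • 1 - I * P + I * y * P : Matrix (Fin m) (Fin m) ℤ) = c • (y * P) := by
      rw [Matrix.mul_add, Matrix.mul_sub, ← Matrix.mul_assoc P I P, Matrix.mul_assoc I,
        ← Matrix.mul_assoc P I, hPI]
      simp [-zsmul_eq_mul, -zsmul_one]
    rw [intAct_apply] at hv
    rw [← hv, Matrix.mulVec_mulVec _ P, hPB, Matrix.smul_mulVec, Matrix.mulVec_smul,
      ← Matrix.mulVec_mulVec]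
    exact cN.zsmul_mem (hyN _) _
  · rw [index_matRange _ hB0, hBdet, Int.natAbs_mul, Int.natAbs_pow]
    have hdetle : y.det.natAbs ≤ w.factorial * (K * R) ^ w := by
      have := Matrix.det_le (A := y) (abv := AbsoluteValue.abs) (x := ((K * R : ℕ) : ℤ))
        fun p q => by
          refine (abs_conjSum_apply_le hb hxR j p q).trans (le_of_eq ?_)
          simp only [K]; push_cast; ring
      simp only [AbsoluteValue.abs_apply, Fintype.card_fin, nsmul_eq_mul] at this
      zify
      exact_mod_cast this
    have hRN : R ^ w ≤ c.natAbs ^ m * N.index := by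
      refine hR.trans ((Nat.le_of_dvd (Nat.pos_of_ne_zero hcN0) hMdvd).trans ?_)
      rw [hcNindex, mul_comm]
    calc c.natAbs ^ m * y.det.natAbs ≤ c.natAbs ^ m * (w.factorial * (K * R) ^ w) := by gcongr
      _ = c.natAbs ^ m * (w.factorial * K ^ w * R ^ w) := by rw [mul_pow]; ring
      _ ≤ c.natAbs ^ m * (w.factorial * K ^ w * (c.natAbs ^ m * N.index)) := by gcongr
      _ = _ := by ring

/-- A finite-dimensional semisimple module splits into coordinate spaces on which every nonzero
endomorphism is invertible. -/
theorem exists_simple_coordinates {A V : Type*} [Ring A] [Algebra ℚ A] [AddCommGroup V]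
    [Module ℚ V] [Module A V] [IsScalarTower ℚ A V] [FiniteDimensional ℚ V]
    [IsSemisimpleModule A V] :
    ∃ (n : ℕ) (w : Fin n → ℕ) (ι : ∀ i, (Fin (w i) → ℚ) →ₗ[ℚ] V)
      (π : ∀ i, V →ₗ[ℚ] (Fin (w i) → ℚ)),
      (∀ i z, π i (ι i z) = z) ∧ (∀ v, ∑ i, ι i (π i v) = v) ∧
      (∀ i (a : A) v, ι i (π i (a • v)) = a • ι i (π i v)) ∧
      ∀ i (y : (Fin (w i) → ℚ) →ₗ[ℚ] (Fin (w i) → ℚ)),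
        (∀ (a : A) z, y (π i (a • ι i z)) = π i (a • ι i (y z))) → y ≠ 0 →
          LinearMap.det y ≠ 0 := by
  classical
  have : Module.Finite A V := Module.Finite.of_restrictScalars_finite ℚ A V
  obtain ⟨n, S, e, hS⟩ := IsSemisimpleModule.exists_linearEquiv_fin_dfinsupp A V
  have hfin : ∀ i, FiniteDimensional ℚ (S i) := fun i =>
    inferInstanceAs (FiniteDimensional ℚ ((S i).restrictScalars ℚ))
  let b : ∀ i, S i ≃ₗ[ℚ] (Fin (Module.finrank ℚ (S i)) → ℚ) := fun i =>
    (Module.finBasis ℚ (S i)).equivFun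
  let inj : ∀ i, S i →ₗ[A] V := fun i => e.symm.toLinearMap ∘ₗ DFinsupp.lsingle (M := fun i => S i) i
  let pr : ∀ i, V →ₗ[A] S i := fun i => DFinsupp.lapply (M := fun i => S i) i ∘ₗ e.toLinearMap
  have hpi : ∀ i s, pr i (inj i s) = s := fun i s => by simp [pr, inj]
  refine ⟨n, fun i => Module.finrank ℚ (S i),
    fun i => (inj i).restrictScalars ℚ ∘ₗ (b i).symm.toLinearMap,
    fun i => (b i).toLinearMap ∘ₗ (pr i).restrictScalars ℚ, fun i z => ?_, fun v => ?_,
    fun i a v => ?_, fun i y hy hy0 => ?_⟩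
  · simp [hpi]
  · simp only [LinearMap.coe_comp, LinearEquiv.coe_coe, Function.comp_apply,
      LinearMap.coe_restrictScalars, LinearEquiv.symm_apply_apply, inj, pr, ← map_sum]
    rw [LinearEquiv.symm_apply_eq]
    ext i : 1
    simp [DFinsupp.single_apply]
  · simp
  · let f : S i →ₗ[A] S i :=
      { toFun := fun s => (b i).symm (y (b i s))
        map_add' := fun s t => by simp
        map_smul' := fun a s => by
          have := hy a (b i s)
          simp only [LinearMap.coe_comp, LinearEquiv.coe_coe, Function.comp_apply,
            LinearMap.coe_restrictScalars, LinearEquiv.symm_apply_apply, map_smul, hpi] at this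
          simp [this] }
    have hf : f ≠ 0 := fun h0 => hy0 <| LinearMap.ext fun z => by
      have := LinearMap.congr_fun h0 ((b i).symm z)
      simpa [f] using this
    have hinj := (LinearMap.bijective_of_ne_zero hf).1
    have hyinj : Function.Injective y := fun z z' hzz => by
      refine (b i).symm.injective (hinj ?_)
      simp [f, hzz]
    exact (LinearMap.isUnit_iff_isUnit_det y).1
      ((LinearMap.isUnit_iff_ker_eq_bot y).2 (LinearMap.ker_eq_bot.2 hyinj)) |>.ne_zero

/-- An integral representation of a finite group splits, after scaling by a nonzero integer, into
integral components on which every nonzero equivariant matrix is nonsingular. -/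
theorem exists_integral_components {H : Type*} [Group H] [Fintype H] {m : ℕ}
    (φ : H →* Matrix.GeneralLinearGroup (Fin m) ℤ) :
    ∃ (n : ℕ) (w : Fin n → ℕ) (I : ∀ i, Matrix (Fin m) (Fin (w i)) ℤ)
      (P : ∀ i, Matrix (Fin (w i)) (Fin m) ℤ) (c : ℤ), c ≠ 0 ∧
      (∀ i, P i * I i = c • 1) ∧ ∑ i, I i * P i = c • 1 ∧
      (∀ i h, I i * P i * (φ h).1 = (φ h).1 * (I i * P i)) ∧
      ∀ i (y : Matrix (Fin (w i)) (Fin (w i)) ℤ),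
        (∀ h, y * (P i * (φ h).1 * I i) = P i * (φ h).1 * I i * y) → y ≠ 0 → y.det ≠ 0 := by
  let Φ : H → Matrix (Fin m) (Fin m) ℚ := fun h => (φ h).1.map (Int.castRingHom ℚ)
  let ρ : Representation ℚ H (Fin m → ℚ) :=
    { toFun := fun h => Matrix.toLin' (Φ h)
      map_one' := by simp [Φ]; rfl
      map_mul' := fun g h => by
        simp only [Φ, map_mul, Units.val_mul, Matrix.map_mul, Matrix.toLin'_mul]; rfl }
  have hρ : ∀ h v, ρ h v = (Φ h).mulVec v := fun h v => Matrix.toLin'_apply _ _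
  have : NeZero (Nat.card H : ℚ) := ⟨by exact_mod_cast Nat.card_pos.ne'⟩
  obtain ⟨n, w, ι, π, hπι, hsum, hcomm, hschur⟩ :=
    exists_simple_coordinates (A := MonoidAlgebra ℚ H) (V := ρ.asModule)
  have hsm : ∀ (h : H) (v : ρ.asModule),
      (MonoidAlgebra.single h (1 : ℚ)) • v = ρ h v := fun h v => by
    rw [Representation.single_smul, one_smul]; rfl
  let ι' : ∀ i, (Fin (w i) → ℚ) →ₗ[ℚ] (Fin m → ℚ) := fun i =>
    ρ.asModuleEquiv.toLinearMap ∘ₗ ι i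
  let π' : ∀ i, (Fin m → ℚ) →ₗ[ℚ] (Fin (w i) → ℚ) := fun i =>
    π i ∘ₗ ρ.asModuleEquiv.symm.toLinearMap
  have hπι' : ∀ i z, π' i (ι' i z) = z := hπι
  have hsum' : ∀ v, ∑ i, ι' i (π' i v) = v := hsum
  have hcomm' : ∀ i h v, ι' i (π' i (ρ h v)) = ρ h (ι' i (π' i v)) := fun i h v => by
    have := hcomm i (MonoidAlgebra.single h 1) (ρ.asModuleEquiv.symm v)
    rw [hsm, hsm] at this
    exact this
  let IQ : ∀ i, Matrix (Fin m) (Fin (w i)) ℚ := fun i => LinearMap.toMatrix' (ι' i)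
  let PQ : ∀ i, Matrix (Fin (w i)) (Fin m) ℚ := fun i => LinearMap.toMatrix' (π' i)
  have hIQ : ∀ i z, (IQ i).mulVec z = ι' i z := fun i z => LinearMap.toMatrix'_mulVec _ _
  have hPQ : ∀ i v, (PQ i).mulVec v = π' i v := fun i v => LinearMap.toMatrix'_mulVec _ _
  have hPIQ : ∀ i, PQ i * IQ i = 1 := fun i => Matrix.ext_of_mulVec_single fun j => by
    rw [← Matrix.mulVec_mulVec, hIQ, hPQ, hπι', Matrix.one_mulVec]
  have hsumQ : ∑ i, IQ i * PQ i = 1 := Matrix.ext_of_mulVec_single fun j => by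
    rw [Matrix.sum_mulVec, Matrix.one_mulVec]
    simp only [← Matrix.mulVec_mulVec, hIQ, hPQ, hsum']
  have hcommQ : ∀ i h, IQ i * PQ i * Φ h = Φ h * (IQ i * PQ i) := fun i h =>
    Matrix.ext_of_mulVec_single fun j => by
      simp only [← Matrix.mulVec_mulVec, ← hρ, hIQ, hPQ, hcomm']
  have hschurQ : ∀ i (y : Matrix (Fin (w i)) (Fin (w i)) ℚ),
      (∀ h, y * (PQ i * Φ h * IQ i) = PQ i * Φ h * IQ i * y) → y ≠ 0 → y.det ≠ 0 := by
    intro i y hy hy0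
    have := hschur i (Matrix.toLin' y) (fun a z => ?_) (by simpa using hy0)
    · simpa using this
    · induction a using MonoidAlgebra.induction_on with
      | of h =>
        have hyz := congrArg (fun M => M.mulVec z) (hy h)
        simp only [← Matrix.mulVec_mulVec, ← hρ, hIQ, hPQ] at hyz
        rw [MonoidAlgebra.of_apply, hsm, hsm]
        exact hyz
      | add a b ha hb => simp only [add_smul, map_add, ha, hb]
      | smul r a ha => simp only [smul_assoc, map_smul, ha]
  obtain ⟨⟨k, hk⟩, hkint⟩ := IsLocalization.exist_integer_multiples_of_finite
    (nonZeroDivisors ℤ) (S := ℚ) (Sum.elim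
      (fun t : Σ i, Fin m × Fin (w i) => IQ t.1 t.2.1 t.2.2)
      (fun t : Σ i, Fin (w i) × Fin m => PQ t.1 t.2.1 t.2.2))
  have hk0 : k ≠ 0 := nonZeroDivisors.ne_zero hk
  choose I hI using fun i p q => hkint (Sum.inl ⟨i, p, q⟩)
  choose P hP using fun i p q => hkint (Sum.inr ⟨i, p, q⟩)
  let f := Int.castRingHom ℚ
  have hinj : ∀ {a b : ℕ} {M N : Matrix (Fin a) (Fin b) ℤ}, M.map f = N.map f → M = N :=
    fun h => Matrix.map_injective (RingHom.injective_int f) h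
  have hIm : ∀ i, (Matrix.of (I i)).map f = (k : ℚ) • IQ i := fun i => by
    ext p q
    simpa using hI i p q
  have hPm : ∀ i, (Matrix.of (P i)).map f = (k : ℚ) • PQ i := fun i => by
    ext p q
    simpa using hP i p q
  have hcm : ∀ a : ℕ, ((k * k) • (1 : Matrix (Fin a) (Fin a) ℤ)).map f = ((k : ℚ) * k) • 1 :=
    fun a => by
      ext p q
      by_cases hpq : p = q <;> simp [f, -zsmul_eq_mul, -zsmul_one, hpq]
  refine ⟨n, w, fun i => Matrix.of (I i), fun i => Matrix.of (P i), k * k, mul_ne_zero hk0 hk0,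
    fun i => hinj ?_, hinj ?_, fun i h => hinj ?_, fun i y hy hy0 hdet => ?_⟩
  · rw [Matrix.map_mul, hIm, hPm, hcm, Matrix.smul_mul, Matrix.mul_smul, hPIQ, smul_smul]
  · rw [hcm, ← hsumQ, ← RingHom.mapMatrix_apply, map_sum, Finset.smul_sum]
    refine Finset.sum_congr rfl fun i _ => ?_
    rw [RingHom.mapMatrix_apply, Matrix.map_mul, hIm, hPm, Matrix.smul_mul, Matrix.mul_smul,
      smul_smul]
  · have hΦ : (φ h).1.map f = Φ h := rfl
    simp only [Matrix.map_mul, hIm, hPm, hΦ, Matrix.smul_mul, Matrix.mul_smul, hcommQ]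
  · refine hschurQ i (y.map f) (fun h => ?_) (fun h0 => hy0 (hinj ?_)) ?_
    · have hΦ : (φ h).1.map f = Φ h := rfl
      have := congrArg (fun M => Matrix.map M f) (hy h)
      simp only [Matrix.map_mul, hIm, hPm, hΦ, Matrix.smul_mul, Matrix.mul_smul] at this
      have hkQ : (k : ℚ) ≠ 0 := by exact_mod_cast hk0
      exact smul_right_injective _ hkQ (smul_right_injective _ hkQ this)
    · rw [h0, Matrix.map_zero _ (map_zero f)]
    · rw [← RingHom.mapMatrix_apply, ← RingHom.map_det, hdet, map_zero]

/-- Passing from invariant subgroups to images of commuting matrices costs at most a constant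
factor in the index. -/
theorem exists_comSet_index_le {H : Type*} [Group H] [Fintype H] {m : ℕ}
    (φ : H →* Matrix.GeneralLinearGroup (Fin m) ℤ) :
    ∃ C : ℕ, 1 ≤ C ∧ ∀ N ∈ InvSet φ, ∀ a ∉ N,
      ∃ N' ∈ ComSet φ, a ∉ N' ∧ N'.index ≤ C * N.index := by
  obtain ⟨n, w, I, P, c, hc, hPI, hsum, hcomm, hschur⟩ := exists_integral_components φ
  choose C hC using fun i =>
    exists_comm_of_component φ (I i) (P i) c hc (hPI i) (hcomm i) (hschur i)
  refine ⟨1 + ∑ i, C i, by omega, fun N hN a ha => ?_⟩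
  obtain ⟨i, hi⟩ : ∃ i, ∀ u ∈ N, (I i * P i).mulVec a ≠ c • u := by
    by_contra! hcon
    choose u hu hue using hcon
    refine ha ?_
    have : c • a = c • ∑ i, u i := by
      rw [Finset.smul_sum, ← Finset.sum_congr rfl fun i _ => hue i, ← Matrix.sum_mulVec, hsum,
        Matrix.smul_mulVec, Matrix.one_mulVec]
    rw [smul_right_injective _ hc this]
    exact N.sum_mem fun i _ => hu i
  obtain ⟨N', hN', haN', hle⟩ := hC i N hN a hi
  refine ⟨N', hN', haN', hle.trans (Nat.mul_le_mul_right _ ?_)⟩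
  have := Finset.single_le_sum (f := C) (fun _ _ => Nat.zero_le _) (Finset.mem_univ i)
  omega

theorem exists_mem_comSet_notMem {H : Type*} [Group H] {m : ℕ}
    (φ : H →* Matrix.GeneralLinearGroup (Fin m) ℤ) {a : Fin m → ℤ} (ha : a ≠ 0) :
    ∃ N ∈ ComSet φ, a ∉ N := by
  obtain ⟨j, hj⟩ := Function.ne_iff.1 ha
  have hc : 2 * a j ≠ 0 := mul_ne_zero two_ne_zero hj
  refine ⟨_, matRange_mem_comSet φ ((2 * a j) • 1) ?_ (fun h => by
    rw [Matrix.smul_mul, Matrix.mul_smul, one_mul, mul_one]), ?_⟩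
  · rw [Matrix.det_smul, Matrix.det_one, mul_one]
    exact pow_ne_zero _ hc
  · rintro ⟨u, hu⟩
    have := congrFun hu j
    rw [intAct_apply, Matrix.smul_mulVec, Matrix.one_mulVec, Pi.smul_apply, smul_eq_mul] at this
    have h1 : a j * (2 * u j - 1) = 0 := by linarith
    rcases mul_eq_zero.1 h1 with h | h
    · exact hj h
    · omega

theorem exists_addDivFn_eq {A : Type*} [AddGroup A] {P : Set (AddSubgroup A)} {a : A}
    (h : ∃ N ∈ P, a ∉ N) : ∃ N ∈ P, a ∉ N ∧ addDivFn P a = N.index := by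
  obtain ⟨N, hN, haN⟩ := h
  exact csInf_mem (s := {n : ℕ∞ | ∃ N ∈ P, a ∉ N ∧ n = (N.index : ℕ∞)}) ⟨_, N, hN, haN, rfl⟩

theorem toNat_addDivFn_le {A : Type*} [AddGroup A] {P : Set (AddSubgroup A)} {a : A}
    {N : AddSubgroup A} (hN : N ∈ P) (ha : a ∉ N) : (addDivFn P a).toNat ≤ N.index :=
  ENat.toNat_le_of_le_natCast (sInf_le ⟨N, hN, ha, rfl⟩)

/-- for an integral representation `φ : H → GL(m,ℤ)` of a finite group,
`RF_{ℤ^m, Inv(φ)} ≈ RF_{ℤ^m, Com(φ)}`. -/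
theorem stmt_17 {H : Type*} [Group H] [Fintype H] {m : ℕ}
    (φ : H →* Matrix.GeneralLinearGroup (Fin m) ℤ)
    (S : Finset (Fin m → ℤ)) (hS : AddSubgroup.closure (S : Set (Fin m → ℤ)) = ⊤) :
    GrowthEquiv (addRF (InvSet φ) S) (addRF (ComSet φ) S) := by
  constructor
  · refine growthLE_addRF_of_addDivFn_le S 1 le_rfl fun a ha => ?_
    obtain ⟨N, hN, haN, he⟩ := exists_addDivFn_eq (exists_mem_comSet_notMem φ ha)
    rw [he, ENat.toNat_natCast, one_mul]
    exact toNat_addDivFn_le hN.1 haN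
  · obtain ⟨C, hC, hCN⟩ := exists_comSet_index_le φ
    refine growthLE_addRF_of_addDivFn_le S C hC fun a ha => ?_
    obtain ⟨N₀, hN₀, haN₀⟩ := exists_mem_comSet_notMem φ ha
    obtain ⟨N, hN, haN, he⟩ := exists_addDivFn_eq ⟨N₀, hN₀.1, haN₀⟩
    obtain ⟨N', hN', haN', hle⟩ := hCN N hN a haN
    rw [he, ENat.toNat_natCast]
    exact (toNat_addDivFn_le hN' haN').trans hle
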